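/- Let R be an Archimedean chain ring with maximal ideal P and let G be an almost FP-injective R-module which is either countably generated or uniserial. Then: (1) p.d.(G) ≤ 1 if R is an IF-ring; (2) p.d.(G) ≤ 2 if R is a valuation domain; (3) p.d.(G) ≤ 3 and p.d.(P ⊗_R G) ≤ 1 if R is not coherent. -/

import Mathlib

open CategoryTheory

universe u

/-- A chain ring: the lattice of ideals is totally ordered by inclusion. -/
def IsChainRing (R : Type u) [CommRing R] : Prop :=
  ∀ I J : Ideal R, I ≤ J ∨ J ≤ I

/-- The set of zero-divisors of `R`. -/
def zeroDivisorsSet (R : Type u) [CommRing R] : Set R :=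
  {r : R | ∃ s : R, s ≠ 0 ∧ r * s = 0}

/-- An `R`-module `E` is FP-injective if `Ext¹_R(F, E) = 0` for every finitely
presented `R`-module `F`. -/
def IsFPInjective (R : Type u) [CommRing R] (E : Type u) [AddCommGroup E] [Module R E] : Prop :=
  ∀ F : ModuleCat.{u} R, Module.FinitePresentation R F →
    Limits.IsZero (((Ext R (ModuleCat.{u} R) 1).obj (Opposite.op F)).obj (ModuleCat.of R E))

/-- A submodule `D ≤ E` is pure if `0 → D ⊗ N → E ⊗ N` is exact for every module `N`,
i.e. the sequence `0 → D → E → E/D → 0` remains exact after tensoring with any module. -/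
def IsPureSubmodule {R : Type u} [CommRing R] {E : Type u} [AddCommGroup E] [Module R E]
    (D : Submodule R E) : Prop :=
  ∀ (N : Type u) [AddCommGroup N] [Module R N],
    Function.Injective (LinearMap.rTensor N D.subtype)

/-- An `R`-module `G` is almost FP-injective if `G ≅ E/D` for some FP-injective module `E`
and pure submodule `D` of `E`. -/
def IsAlmostFPInjective (R : Type u) [CommRing R] (G : Type u) [AddCommGroup G]
    [Module R G] : Prop :=
  ∃ (E : Type u) (_ : AddCommGroup E) (_ : Module R E) (D : Submodule R E),
    IsFPInjective R E ∧ IsPureSubmodule D ∧ Nonempty ((E ⧸ D) ≃ₗ[R] G)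

/-- The weak dimension of a module, as an element of `ℕ∞`: the least `n` such that
`Tor_{n+1}(M, N) = 0` for all modules `N` (and `⊤ = ∞` if there is no such `n`). -/
noncomputable def weakDim (R : Type u) [CommRing R] (M : Type u) [AddCommGroup M]
    [Module R M] : ℕ∞ :=
  sInf {n : ℕ∞ | ∃ k : ℕ, n = k ∧ ∀ N : ModuleCat.{u} R,
    Limits.IsZero (((Tor (ModuleCat.{u} R) (k + 1)).obj (ModuleCat.of R M)).obj N)}

/-- The projective dimension of a module, as an element of `ℕ∞`: the least `n` such that
`Ext^{n+1}(M, N) = 0` for all modules `N` (and `⊤ = ∞` if there is no such `n`). -/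
noncomputable def projDim (R : Type u) [CommRing R] (M : Type u) [AddCommGroup M]
    [Module R M] : ℕ∞ :=
  sInf {n : ℕ∞ | ∃ k : ℕ, n = k ∧ ∀ N : ModuleCat.{u} R,
    Limits.IsZero (((Ext R (ModuleCat.{u} R) (k + 1)).obj
      (Opposite.op (ModuleCat.of R M))).obj N)}

/-- An IF-ring: every injective module is flat. -/
def IsIFRing (R : Type u) [CommRing R] : Prop :=
  ∀ (M : Type u) [AddCommGroup M] [Module R M], Module.Injective R M → Module.Flat R M

/-- A semicoherent ring: `Hom_R(E, F)` embeds into a flat module for every pair of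
injective modules `E`, `F`. -/
def IsSemicoherent (R : Type u) [CommRing R] : Prop :=
  ∀ (E F : Type u) [AddCommGroup E] [Module R E] [AddCommGroup F] [Module R F],
    Module.Injective R E → Module.Injective R F →
      ∃ (W : Type u) (_ : AddCommGroup W) (_ : Module R W),
        Module.Flat R W ∧ ∃ f : (E →ₗ[R] F) →ₗ[R] W, Function.Injective f

/-- A coherent ring: every finitely generated ideal is finitely presented. -/
def IsCoherentRing (R : Type u) [CommRing R] : Prop :=
  ∀ I : Ideal R, I.FG → Module.FinitePresentation R I

/-- `i : M →ₗ[R] E` exhibits `E` as an injective hull of `M`: `E` is injective and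
`i` is an essential embedding. -/
def IsInjectiveHull (R : Type u) [CommRing R] (M E : Type u) [AddCommGroup M] [Module R M]
    [AddCommGroup E] [Module R E] (i : M →ₗ[R] E) : Prop :=
  Module.Injective R E ∧ Function.Injective i ∧
    ∀ K : Submodule R E, K ≠ ⊥ → K ⊓ LinearMap.range i ≠ ⊥

/-- The bottom prime ideal `M_♯` (as a set): elements killing some nonzero element of `M`. -/
def bottomSet (R : Type u) [CommRing R] (M : Type u) [AddCommGroup M] [Module R M] : Set R :=
  {s : R | ∃ x : M, x ≠ 0 ∧ s • x = 0}

/-- The top prime ideal `M^♯` (as a set): elements `s` with `sM ⊊ M`. -/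
def topSet (R : Type u) [CommRing R] (M : Type u) [AddCommGroup M] [Module R M] : Set R :=
  {s : R | ¬ Function.Surjective fun x : M => s • x}

theorem isZero_ext_succ_iff {R : Type u} [CommRing R] (X Y : ModuleCat.{u} R) (n : ℕ) :
    Limits.IsZero (((Ext R (ModuleCat.{u} R) (n + 1)).obj (Opposite.op X)).obj Y) ↔
      ∀ e : Abelian.Ext.{u} X Y (n + 1), e = 0 := by
  let P := projectiveResolution X
  rw [(P.isoExt (R := R) (n + 1) Y).isZero_iff, ← HomologicalComplex.exactAt_iff_isZero_homology,
    HomologicalComplex.exactAt_iff' _ n (n + 1) (n + 2) (by simp) (by simp),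
    ShortComplex.moduleCat_exact_iff]
  constructor
  · intro h e
    obtain ⟨f, hf, rfl⟩ := P.extMk_surjective e (n + 2) rfl
    rw [P.extMk_eq_zero_iff f (n + 2) rfl hf n rfl]
    exact h f hf
  · intro h f hf
    exact (P.extMk_eq_zero_iff f (n + 2) rfl hf n rfl).1 (h _)

theorem projDim_le_of_hasProjectiveDimensionLT {R : Type u} [CommRing R] {M : Type u}
    [AddCommGroup M] [Module R M] {k : ℕ}
    (h : HasProjectiveDimensionLT (ModuleCat.of R M) (k + 1)) : projDim R M ≤ k :=
  sInf_le ⟨k, rfl, fun _ => (isZero_ext_succ_iff _ _ _).2 fun e =>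
    e.eq_zero_of_hasProjectiveDimensionLT (k + 1) le_rfl⟩

section Exact

variable {R : Type u} [CommRing R] {A B C : Type u} [AddCommGroup A] [Module R A]
  [AddCommGroup B] [Module R B] [AddCommGroup C] [Module R C] {f : A →ₗ[R] B} {g : B →ₗ[R] C}

theorem shortExact_of_function_exact (hf : Function.Injective f) (hg : Function.Surjective g)
    (hfg : Function.Exact f g) :
    (ModuleCat.shortComplexOfCompEqZero f g hfg.linearMap_comp_eq_zero).ShortExact :=
  ModuleCat.shortComplex_shortExact _ hfg hf hg

theorem hasProjectiveDimensionLT_right_of_exact {n : ℕ} (hf : Function.Injective f)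
    (hg : Function.Surjective g) (hfg : Function.Exact f g)
    (hA : HasProjectiveDimensionLT (ModuleCat.of R A) n)
    (hB : HasProjectiveDimensionLT (ModuleCat.of R B) (n + 1)) :
    HasProjectiveDimensionLT (ModuleCat.of R C) (n + 1) :=
  (shortExact_of_function_exact hf hg hfg).hasProjectiveDimensionLT_X₃ n hA hB

theorem hasProjectiveDimensionLT_middle_of_exact {n : ℕ} (hf : Function.Injective f)
    (hg : Function.Surjective g) (hfg : Function.Exact f g)
    (hA : HasProjectiveDimensionLT (ModuleCat.of R A) n)
    (hC : HasProjectiveDimensionLT (ModuleCat.of R C) n) :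
    HasProjectiveDimensionLT (ModuleCat.of R B) n :=
  (shortExact_of_function_exact hf hg hfg).hasProjectiveDimensionLT_X₂ n hA hC

theorem hasProjectiveDimensionLT_left_of_exact {n : ℕ} (hf : Function.Injective f)
    (hg : Function.Surjective g) (hfg : Function.Exact f g)
    (hB : HasProjectiveDimensionLT (ModuleCat.of R B) n)
    (hC : HasProjectiveDimensionLT (ModuleCat.of R C) (n + 1)) :
    HasProjectiveDimensionLT (ModuleCat.of R A) n :=
  (shortExact_of_function_exact hf hg hfg).hasProjectiveDimensionLT_X₁ n hB hC

theorem hasProjectiveDimensionLT_of_linearEquiv {n : ℕ} (e : A ≃ₗ[R] B)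
    (hA : HasProjectiveDimensionLT (ModuleCat.of R A) n) :
    HasProjectiveDimensionLT (ModuleCat.of R B) n :=
  hasProjectiveDimensionLT_of_iso e.toModuleIso n

end Exact

theorem hasProjectiveDimensionLT_succ_of_projective {R : Type u} [CommRing R] (M : Type u)
    [AddCommGroup M] [Module R M] [Module.Projective R M] (n : ℕ) :
    HasProjectiveDimensionLT (ModuleCat.of R M) (n + 1) := by
  have : Projective (ModuleCat.of R M) := (IsProjective.iff_projective M).1 ‹_›
  exact hasProjectiveDimensionLT_of_ge _ 1 _ (by omega)

theorem exact_finsupp_mapRange {R : Type u} [CommRing R] {A B C : Type u} [AddCommGroup A]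
    [Module R A] [AddCommGroup B] [Module R B] [AddCommGroup C] [Module R C] {f : A →ₗ[R] B}
    {g : B →ₗ[R] C} (ι : Type u) (hf : Function.Injective f) (hfg : Function.Exact f g) :
    Function.Exact (Finsupp.mapRange.linearMap (α := ι) f) (Finsupp.mapRange.linearMap g) := by
  rw [LinearMap.exact_iff, Finsupp.ker_mapRange, Finsupp.range_mapRange_linearMap,
    hfg.linearMap_ker_eq]
  exact LinearMap.ker_eq_bot.2 hf

theorem hasProjectiveDimensionLT_finsupp {R : Type u} [CommRing R] (ι : Type u) (n : ℕ) :
    ∀ (M : Type u) [AddCommGroup M] [Module R M],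
      HasProjectiveDimensionLT (ModuleCat.of R M) (n + 1) →
        HasProjectiveDimensionLT (ModuleCat.of R (ι →₀ M)) (n + 1) := by
  induction n with
  | zero =>
    intro M _ _ h
    have : Projective (ModuleCat.of R M) := inferInstance
    have : Module.Projective R M := (IsProjective.iff_projective M).2 this
    have : Module.Projective R (ι →₀ M) := by
      classical exact .of_equiv (finsuppLequivDFinsupp R).symm
    exact hasProjectiveDimensionLT_succ_of_projective _ 0
  | succ n ih =>
    intro M _ _ h
    let p := Finsupp.linearCombination R (id : M → M)
    have hp : Function.Surjective p := Finsupp.linearCombination_id_surjective R M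
    have hK := hasProjectiveDimensionLT_left_of_exact (A := LinearMap.ker p)
      (LinearMap.ker p).injective_subtype hp
      (LinearMap.exact_subtype_ker_map p) (hasProjectiveDimensionLT_succ_of_projective _ n) h
    have hi := (LinearMap.ker p).injective_subtype
    refine hasProjectiveDimensionLT_right_of_exact
      (Finsupp.mapRange_injective _ (map_zero _) hi) (Finsupp.mapRange_surjective _ (map_zero _) hp)
      (exact_finsupp_mapRange ι hi (LinearMap.exact_subtype_ker_map p)) (ih _ hK)
      (hasProjectiveDimensionLT_succ_of_projective _ _)

/-- A module killed by a maximal ideal `P` has projective dimension at most that of `R ⧸ P`. -/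
theorem hasProjectiveDimensionLT_of_forall_smul_eq_zero {R : Type u} [CommRing R] (P : Ideal R)
    [P.IsMaximal] {n : ℕ} (hP : HasProjectiveDimensionLT (ModuleCat.of R (R ⧸ P)) (n + 1))
    (V : Type u) [AddCommGroup V] [Module R V] (hV : ∀ p ∈ P, ∀ v : V, p • v = 0) :
    HasProjectiveDimensionLT (ModuleCat.of R V) (n + 1) := by
  let : Field (R ⧸ P) := Ideal.Quotient.field P
  have hT : Module.IsTorsionBySet R V P := fun v p => hV p p.2 v
  let : Module (R ⧸ P) V := hT.module
  have : IsScalarTower R (R ⧸ P) V := hT.isScalarTower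
  let b := Module.Basis.ofVectorSpace (R ⧸ P) V
  exact hasProjectiveDimensionLT_of_linearEquiv (b.repr.restrictScalars R).symm
    (hasProjectiveDimensionLT_finsupp _ n _ hP)

/-- The submodule `N` has a countable generating set. -/
def Submodule.IsCountablySpanned {R : Type*} [Semiring R] {M : Type*} [AddCommMonoid M]
    [Module R M] (N : Submodule R M) : Prop :=
  ∃ S : Set M, S.Countable ∧ Submodule.span R S = N

theorem Submodule.FG.isCountablySpanned {R : Type*} [Semiring R] {M : Type*} [AddCommMonoid M]
    [Module R M] {N : Submodule R M} (h : N.FG) : N.IsCountablySpanned :=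
  let ⟨S, hS⟩ := h
  ⟨S, S.countable_toSet, hS⟩

theorem Submodule.IsCountablySpanned.exists_span_range {R : Type*} [Semiring R] {M : Type*}
    [AddCommMonoid M] [Module R M] {N : Submodule R M} (h : N.IsCountablySpanned) :
    ∃ k : ℕ → M, Submodule.span R (Set.range k) = N := by
  obtain ⟨S, hS, rfl⟩ := h
  obtain ⟨k, hk⟩ := (hS.insert (0 : M)).exists_eq_range ⟨0, Set.mem_insert _ _⟩
  exact ⟨k, by rw [← hk, Submodule.span_insert_zero]⟩

theorem Submodule.IsCountablySpanned.top {R : Type*} [Semiring R] {M : Type*}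
    [AddCommMonoid M] [Module R M] {N : Submodule R M} (h : N.IsCountablySpanned) :
    (⊤ : Submodule R N).IsCountablySpanned := by
  obtain ⟨S, hS, rfl⟩ := h
  exact ⟨_, hS.preimage Subtype.val_injective, Submodule.span_span_coe_preimage⟩

theorem isCountablySpanned_top_tensorProduct {R : Type*} [CommRing R] {M N : Type*}
    [AddCommGroup M] [Module R M] [AddCommGroup N] [Module R N]
    (hM : (⊤ : Submodule R M).IsCountablySpanned) (hN : (⊤ : Submodule R N).IsCountablySpanned) :
    (⊤ : Submodule R (TensorProduct R M N)).IsCountablySpanned := by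
  obtain ⟨S, hS, hS'⟩ := hM
  obtain ⟨T, hT, hT'⟩ := hN
  exact ⟨_, hS.image2 hT fun x y => TensorProduct.mk R M N x y, by
    rw [← Submodule.map₂_span_span, hS', hT', TensorProduct.map₂_mk_top_top_eq_top]⟩

/-- If all ideals are countably generated, then so are the submodules of a free module of countable
rank. -/
theorem isCountablySpanned_of_finsupp_nat {R : Type u} [CommRing R]
    (hR : ∀ I : Ideal R, I.IsCountablySpanned) (K : Submodule R (ℕ →₀ R)) :
    K.IsCountablySpanned := by
  let L (n : ℕ) : Submodule R (ℕ →₀ R) := Finsupp.supported R R (Set.Iic n)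
  choose S hS hSI using fun n => hR ((K ⊓ L n).map (Finsupp.lapply n))
  have hmem (n : ℕ) (r : S n) : ∃ k ∈ K ⊓ L n, k n = r := by
    have : (r : R) ∈ Submodule.span R (S n) := Submodule.subset_span r.2
    rw [hSI] at this
    exact this
  choose k hk hkr using hmem
  refine ⟨⋃ n, Set.range (k n), Set.countable_iUnion fun n => ?_, le_antisymm ?_ fun x hx => ?_⟩
  · have := (hS n).to_subtype
    exact Set.countable_range _
  · refine Submodule.span_le.2 (Set.iUnion_subset fun n => ?_)
    rintro _ ⟨r, rfl⟩
    exact (hk n r).1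
  · set T := Submodule.span R (⋃ n, Set.range (k n))
    have hTK : T ≤ K := by
      refine Submodule.span_le.2 (Set.iUnion_subset fun n => ?_)
      rintro _ ⟨r, rfl⟩
      exact (hk n r).1
    have key (n : ℕ) : ∀ x ∈ K, (∀ i, n ≤ i → x i = 0) → x ∈ T := by
      induction n with
      | zero =>
        intro x _ h
        rw [show x = 0 from Finsupp.ext fun i => h i (Nat.zero_le i)]
        exact T.zero_mem
      | succ n ih =>
        intro x hx h
        have hxL : x ∈ L n := (Finsupp.mem_supported' R x).2 fun i hi =>
          h i (by simpa using hi)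
        have hle : Submodule.span R (S n) ≤ (T ⊓ L n).map (Finsupp.lapply n) :=
          Submodule.span_le.2 fun r hr => ⟨k n ⟨r, hr⟩, ⟨Submodule.subset_span
            (Set.mem_iUnion.2 ⟨n, ⟨r, hr⟩, rfl⟩), (hk n _).2⟩, hkr n _⟩
        obtain ⟨z, ⟨hzT, hzL⟩, hz⟩ := hle (show x n ∈ _ by
          rw [hSI]
          exact ⟨x, ⟨hx, hxL⟩, rfl⟩)
        have hz : z n = x n := hz
        have := ih (x - z) (K.sub_mem hx (hTK hzT)) fun i hi => by
          rcases hi.eq_or_lt with rfl | hi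
          · simp [hz]
          · rw [Finsupp.sub_apply, h i hi, (Finsupp.mem_supported' R z).1 hzL i (by simpa using hi),
              sub_zero]
        simpa using T.add_mem this hzT
    obtain ⟨n, hn⟩ := x.support.bddAbove
    refine key (n + 1) x hx fun i hi => ?_
    by_contra h
    exact absurd (hn (Finsupp.mem_support_iff.2 h)) (by omega)

/-- A linear map onto a countably generated module splits as soon as it has sections over every
finite set of elements. -/
theorem exists_section_of_forall_finset {R : Type*} [CommRing R] {K F : Type*} [AddCommGroup K]
    [Module R K] [AddCommGroup F] [Module R F] (q : F →ₗ[R] K)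
    (hK : (⊤ : Submodule R K).IsCountablySpanned)
    (h : ∀ s : Finset K, ∃ t : K →ₗ[R] F, ∀ x ∈ s, q (t x) = x) :
    ∃ t : K →ₗ[R] F, q ∘ₗ t = LinearMap.id := by
  classical
  obtain ⟨k, hk⟩ := hK.exists_span_range
  choose t ht using h
  let step (n : ℕ) (σ : K →ₗ[R] F) : K →ₗ[R] F :=
    σ + t ((Finset.range (n + 1)).image fun i => k i - q (σ (k i))) ∘ₗ (LinearMap.id - q ∘ₗ σ)
  let σ (n : ℕ) : K →ₗ[R] F := Nat.rec 0 step n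
  have hσ (n : ℕ) : σ (n + 1) = step n (σ n) := rfl
  have hq (n i : ℕ) (hi : i < n) : q (σ n (k i)) = k i := by
    cases n with
    | zero => omega
    | succ n =>
      have := ht _ _ (Finset.mem_image_of_mem (fun i => k i - q (σ n (k i)))
        (Finset.mem_range.2 hi))
      simp [hσ, step, -map_sub, this]
  have hc (i n : ℕ) (hn : i + 1 ≤ n) : σ n (k i) = σ (i + 1) (k i) := by
    induction n, hn using Nat.le_induction with
    | base => rfl
    | succ n hn ih =>
      rw [← ih, hσ]
      simp [step, hq n i hn]
  have hev (x : K) : ∃ y, ∀ᶠ n in Filter.atTop, σ n x = y := by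
    have hx : x ∈ Submodule.span R (Set.range k) := hk ▸ Submodule.mem_top
    induction hx using Submodule.span_induction with
    | mem x hx =>
      obtain ⟨i, rfl⟩ := hx
      exact ⟨_, Filter.eventually_atTop.2 ⟨i + 1, hc i⟩⟩
    | zero => exact ⟨0, by simp⟩
    | add x y _ _ hx hy =>
      obtain ⟨a, ha⟩ := hx
      obtain ⟨b, hb⟩ := hy
      exact ⟨a + b, by filter_upwards [ha, hb] with n h₁ h₂; rw [map_add, h₁, h₂]⟩
    | smul r x _ hx =>
      obtain ⟨a, ha⟩ := hx
      exact ⟨r • a, by filter_upwards [ha] with n h₁; rw [map_smul, h₁]⟩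
  choose y hy using hev
  let τ : K →ₗ[R] F :=
    { toFun := y
      map_add' := fun a b => by
        obtain ⟨n, h₁, h₂, h₃⟩ := (((hy a).and ((hy b).and (hy (a + b)))).exists)
        rw [← h₁, ← h₂, ← h₃, map_add]
      map_smul' := fun r a => by
        obtain ⟨n, h₁, h₂⟩ := ((hy a).and (hy (r • a))).exists
        rw [← h₁, ← h₂, map_smul, RingHom.id_apply] }
  refine ⟨τ, LinearMap.ext_on_range hk fun i => ?_⟩
  obtain ⟨n, h₁, h₂⟩ := ((hy (k i)).and (Filter.eventually_gt_atTop i)).exists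
  change q (y (k i)) = k i
  rw [← h₁, hq n i h₂]

/-- If `M` is flat and `p : F → M` is a surjection from a free module, then any map onto `ker p`
has sections over finite sets of elements. -/
theorem exists_section_on_finset_of_flat {R : Type*} [CommRing R] {M F ι : Type*} [AddCommGroup M]
    [Module R M] [Module.Flat R M] [AddCommGroup F] [Module R F] {p : (ι →₀ R) →ₗ[R] M}
    (hp : Function.Surjective p) (q : F →ₗ[R] LinearMap.ker p) (hq : Function.Surjective q)
    (s : Finset (LinearMap.ker p)) :
    ∃ t : LinearMap.ker p →ₗ[R] F, ∀ x ∈ s, q (t x) = x := by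
  classical
  let T : Finset ι := s.biUnion fun x => (x : ι →₀ R).support
  let i : (T →₀ R) →ₗ[R] (ι →₀ R) := Finsupp.lmapDomain R R Subtype.val
  let r : (ι →₀ R) →ₗ[R] (T →₀ R) := Finsupp.lsubtypeDomain (T : Set ι)
  have hir (x : LinearMap.ker p) (hx : x ∈ s) : i (r x) = x := by
    ext j
    by_cases hj : j ∈ T
    · exact Finsupp.mapDomain_apply Subtype.val_injective _ (⟨j, hj⟩ : T)
    · rw [show i (r x) j = 0 from Finsupp.mapDomain_of_notMem_range _ _ (by simpa using hj)]
      by_contra h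
      exact hj (Finset.mem_biUnion.2 ⟨x, hx, Finsupp.mem_support_iff.2 (Ne.symm h)⟩)
  let K₀ : Submodule R (T →₀ R) :=
    Submodule.span R (s.image fun x : LinearMap.ker p => r x : Finset (T →₀ R))
  have : Module.Finite R K₀ := Module.Finite.span_finset R _
  have h₀ : (p ∘ₗ i) ∘ₗ K₀.subtype = 0 := by
    have : K₀ ≤ LinearMap.ker (p ∘ₗ i) := by
      refine Submodule.span_le.2 fun z hz => ?_
      obtain ⟨x, hx, rfl⟩ := Finset.mem_image.1 (Finset.mem_coe.1 hz)
      simp [hir x hx]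
    ext z
    exact this z.2
  obtain ⟨k, a, y, hay, haf⟩ :=
    Module.Flat.exists_factorization_of_comp_eq_zero_of_free (K := K₀) h₀
  obtain ⟨y', hy'⟩ := Module.projective_lifting_property p y hp
  let θ : (T →₀ R) →ₗ[R] LinearMap.ker p := (i - y' ∘ₗ a).codRestrict _ fun z => by
    have h₁ := LinearMap.congr_fun hay z
    have h₂ := LinearMap.congr_fun hy' (a z)
    rw [LinearMap.mem_ker, LinearMap.sub_apply, map_sub, sub_eq_zero]
    exact h₁.trans h₂.symm
  obtain ⟨u, hu⟩ := Module.projective_lifting_property q θ hq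
  refine ⟨u ∘ₗ r ∘ₗ (LinearMap.ker p).subtype, fun x hx => ?_⟩
  have hz : a (r x) = 0 := LinearMap.congr_fun haf ⟨r x, Submodule.subset_span
    (Finset.mem_coe.2 (Finset.mem_image_of_mem _ hx))⟩
  refine (LinearMap.congr_fun hu (r x)).trans (Subtype.ext ?_)
  simp [θ, hz, hir x hx]

theorem Submodule.IsCountablySpanned.exists_surjective {R : Type*} [CommRing R] {M : Type*}
    [AddCommGroup M] [Module R M] (hM : (⊤ : Submodule R M).IsCountablySpanned) :
    ∃ p : (ℕ →₀ R) →ₗ[R] M, Function.Surjective p := by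
  obtain ⟨k, hk⟩ := hM.exists_span_range
  exact ⟨Finsupp.linearCombination R k, LinearMap.range_eq_top.1 <| by
    rw [Finsupp.range_linearCombination, hk]⟩

/-- Countably generated flat modules over a ring all of whose ideals are countably generated have
projective dimension at most one. -/
theorem hasProjectiveDimensionLT_two_of_flat {R : Type u} [CommRing R]
    (hR : ∀ I : Ideal R, I.IsCountablySpanned) (M : Type u) [AddCommGroup M] [Module R M]
    [Module.Flat R M] (hM : (⊤ : Submodule R M).IsCountablySpanned) :
    HasProjectiveDimensionLT (ModuleCat.of R M) 2 := by
  obtain ⟨p, hp⟩ := hM.exists_surjective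
  have hK := (isCountablySpanned_of_finsupp_nat hR (LinearMap.ker p)).top
  obtain ⟨q, hq⟩ := Submodule.IsCountablySpanned.exists_surjective (M := LinearMap.ker p) hK
  obtain ⟨t, ht⟩ := exists_section_of_forall_finset (K := LinearMap.ker p) q hK
    (exists_section_on_finset_of_flat hp q hq)
  have : Module.Projective R (LinearMap.ker p) := .of_split t q ht
  exact hasProjectiveDimensionLT_right_of_exact (A := LinearMap.ker p)
    (LinearMap.ker p).injective_subtype hp (LinearMap.exact_subtype_ker_map p)
    (hasProjectiveDimensionLT_succ_of_projective _ 0)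
    (hasProjectiveDimensionLT_succ_of_projective _ 1)

namespace IsChainRing

variable {R : Type u} [CommRing R]

theorem dvd_total (hR : IsChainRing R) (a b : R) : a ∣ b ∨ b ∣ a := by
  simpa only [Ideal.span_singleton_le_span_singleton] using hR (Ideal.span {b}) (Ideal.span {a})

theorem exists_eq_span_singleton (hR : IsChainRing R) {I : Ideal R} (hI : I.FG) :
    ∃ a, I = Ideal.span {a} := by
  have : IsBezout R := IsBezout.iff_span_pair_isPrincipal.2 fun a b => by
    rcases hR.dvd_total a b with h | h
    · exact ⟨a, by rw [Ideal.span_pair_comm]; exact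
        Submodule.span_insert_eq_span (Ideal.mem_span_singleton.2 h)⟩
    · exact ⟨b, Submodule.span_insert_eq_span (Ideal.mem_span_singleton.2 h)⟩
  obtain ⟨a, ha⟩ := IsBezout.isPrincipal_of_FG I hI
  exact ⟨a, ha⟩

theorem mem_or_forall_dvd (hR : IsChainRing R) (I : Ideal R) (a : R) :
    a ∈ I ∨ ∀ x ∈ I, a ∣ x := by
  refine (hR (Ideal.span {a}) I).imp (fun h => h (Ideal.mem_span_singleton_self a))
    fun h x hx => Ideal.mem_span_singleton.1 (h hx)

variable {M : Type*} [AddCommGroup M] [Module R M]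

theorem exists_eq_smul_of_mem_smul_top (hR : IsChainRing R) {I : Ideal R} {m : M}
    (hm : m ∈ I • (⊤ : Submodule R M)) : ∃ b ∈ I, ∃ y : M, m = b • y := by
  induction hm using Submodule.smul_induction_on' with
  | smul r hr n _ => exact ⟨r, hr, n, rfl⟩
  | add x _ y _ hx hy =>
    obtain ⟨b, hb, v, rfl⟩ := hx
    obtain ⟨c, hc, w, rfl⟩ := hy
    rcases hR.dvd_total b c with ⟨d, rfl⟩ | ⟨d, rfl⟩
    · exact ⟨b, hb, v + d • w, by rw [smul_add, mul_smul]⟩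
    · exact ⟨c, hc, d • v + w, by rw [smul_add, mul_smul]⟩

/-- Flatness over a chain ring: `M` is flat iff each `a` has annihilator `(0 : a) M`
in `M`. -/
theorem flat_iff (hR : IsChainRing R) :
    Module.Flat R M ↔ ∀ (a : R) (m : M), a • m = 0 → ∃ b, a * b = 0 ∧ ∃ y : M, m = b • y := by
  constructor
  · intro _ a m h
    obtain ⟨k, c, y, h₁, h₂⟩ := Module.Flat.isTrivialRelation_of_sum_smul_eq_zero (ι := Unit)
      (f := fun _ => a) (x := fun _ => m) (by simpa using h)
    have : m ∈ LinearMap.ker (LinearMap.mulLeft R a) • (⊤ : Submodule R M) := by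
      rw [show m = _ from h₁ ()]
      exact Submodule.sum_mem _ fun j _ => Submodule.smul_mem_smul
        (by simpa using h₂ j) Submodule.mem_top
    obtain ⟨b, hb, hy⟩ := hR.exists_eq_smul_of_mem_smul_top this
    exact ⟨b, hb, hy⟩
  · intro h
    refine Module.Flat.iff_lift_lsmul_comp_subtype_injective.2 fun I hI => ?_
    obtain ⟨a, rfl⟩ := hR.exists_eq_span_singleton hI
    let a' : Ideal.span {a} := ⟨a, Ideal.mem_span_singleton_self a⟩
    have key (z : TensorProduct R (Ideal.span {a}) M) : ∃ m, z = a' ⊗ₜ[R] m := by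
      induction z using TensorProduct.induction_on with
      | zero => exact ⟨0, by simp⟩
      | tmul x m =>
        obtain ⟨r, hr⟩ := Ideal.mem_span_singleton'.1 x.2
        exact ⟨r • m, by rw [← TensorProduct.smul_tmul]; congr 1; exact Subtype.ext hr.symm⟩
      | add x y hx hy =>
        obtain ⟨m, rfl⟩ := hx
        obtain ⟨n, rfl⟩ := hy
        exact ⟨m + n, by rw [TensorProduct.tmul_add]⟩
    refine (injective_iff_map_eq_zero _).2 fun z hz => ?_
    obtain ⟨m, rfl⟩ := key z
    obtain ⟨b, hb, y, rfl⟩ := h a m (by simpa [a'] using hz)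
    rw [← TensorProduct.smul_tmul, show b • a' = 0 from Subtype.ext (by
      simpa [a', mul_comm] using hb), TensorProduct.zero_tmul]

variable [IsLocalRing R]

open IsLocalRing

theorem exists_eq_mul_of_not_fg (hR : IsChainRing R) {I : Ideal R} (hI : ¬ I.FG) {a : R}
    (ha : a ∈ I) : ∃ b ∈ I, ∃ p ∈ maximalIdeal R, a = p * b := by
  by_contra! h
  refine hI ⟨{a}, le_antisymm ?_ fun b hb => ?_⟩
  · simpa [Ideal.span_le] using ha
  · rw [Finset.coe_singleton]
    refine Ideal.mem_span_singleton.2 ((hR.dvd_total a b).elim id ?_)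
    rintro ⟨c, hc⟩
    have hcu : IsUnit c := by
      by_contra hcu
      exact h b hb c ((mem_maximalIdeal c).2 hcu) (by rw [hc, mul_comm])
    rw [hc]
    exact (hcu.dvd_mul_right.1 dvd_rfl)

end IsChainRing

/-- The maximal ideal is the only nonzero prime ideal. -/
def IsArchimedeanLocalRing (R : Type u) [CommRing R] [IsLocalRing R] : Prop :=
  ∀ I : Ideal R, I.IsPrime → I ≠ ⊥ → I = IsLocalRing.maximalIdeal R

namespace IsArchimedeanLocalRing

open IsLocalRing

variable {R : Type u} [CommRing R] [IsLocalRing R]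

theorem exists_pow_mem (h : IsArchimedeanLocalRing R) {I : Ideal R} (hI : I ≠ ⊥) {s : R}
    (hs : s ∈ maximalIdeal R) : ∃ n, s ^ n ∈ I := by
  change s ∈ I.radical
  rw [Ideal.radical_eq_sInf]
  refine Submodule.mem_sInf.2 fun J hJ => ?_
  rw [h J hJ.2 fun hJ' => hI (le_bot_iff.1 (hJ' ▸ hJ.1))]
  exact hs

theorem exists_pow_eq_mul (h : IsArchimedeanLocalRing R) {a s : R} (ha : a ≠ 0)
    (hs : s ∈ maximalIdeal R) : ∃ n, a ∣ s ^ n := by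
  obtain ⟨n, hn⟩ := h.exists_pow_mem (I := Ideal.span {a}) (by simpa using ha) hs
  exact ⟨n, Ideal.mem_span_singleton.1 hn⟩

end IsArchimedeanLocalRing

theorem IsLocalRing.eq_zero_of_eq_mul {R : Type u} [CommRing R] [IsLocalRing R] {M : Type*}
    [AddCommGroup M] [Module R M] {p : R} (hp : p ∈ maximalIdeal R) {x : M} (h : x = p • x) :
    x = 0 := by
  have hu : IsUnit (1 - p) := by
    by_contra hu
    exact (maximalIdeal.isMaximal R).ne_top ((Ideal.eq_top_iff_one _).2 (by
      simpa using Ideal.add_mem _ ((mem_maximalIdeal (1 - p)).2 hu) hp))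
  exact (hu.smul_eq_zero).1 (by rw [sub_smul, one_smul, ← h, sub_self])

namespace IsChainRing

open IsLocalRing

variable {R : Type u} [CommRing R] [IsLocalRing R]

theorem exists_seq_dvd (hR : IsChainRing R) (harch : IsArchimedeanLocalRing R) :
    ∃ s : ℕ → R, (∀ n, s n ∈ maximalIdeal R) ∧ ∀ x ∈ maximalIdeal R, ∃ n, s n ∣ x := by
  by_cases hP : (maximalIdeal R).FG
  · obtain ⟨a, ha⟩ := hR.exists_eq_span_singleton hP
    refine ⟨fun _ => a, fun _ => ha ▸ Ideal.mem_span_singleton_self a, fun x hx => ⟨0, ?_⟩⟩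
    rwa [ha, Ideal.mem_span_singleton] at hx
  obtain ⟨s₀, hs₀, hs₀'⟩ := (maximalIdeal R).exists_mem_ne_zero_of_ne_bot
    fun h => hP (h ▸ Submodule.fg_bot)
  have hsq (s : maximalIdeal R) : ∃ t : maximalIdeal R, (t : R) ^ 2 ∣ s := by
    obtain ⟨b, hb, p, hp, h⟩ := hR.exists_eq_mul_of_not_fg hP s.2
    rcases hR.dvd_total b p with hd | hd
    · exact ⟨⟨b, hb⟩, by rw [h, sq]; exact mul_dvd_mul_right hd b⟩
    · exact ⟨⟨p, hp⟩, by rw [h, sq]; exact mul_dvd_mul_left p hd⟩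
  choose f hf using hsq
  let s (n : ℕ) : maximalIdeal R := f^[n] ⟨s₀, hs₀⟩
  have hs (n : ℕ) : (s n : R) ^ 2 ^ n ∣ s₀ := by
    induction n with
    | zero => simp [s]
    | succ n ih =>
      refine dvd_trans ?_ ih
      rw [pow_succ', pow_mul]
      refine pow_dvd_pow_of_dvd ?_ _
      simpa only [s, Function.iterate_succ_apply'] using hf (s n)
  refine ⟨fun n => s n, fun n => (s n).2, fun x hx => ?_⟩
  by_contra! h
  obtain ⟨m, c, hc⟩ := harch.exists_pow_eq_mul hs₀' hx
  obtain ⟨d, hd⟩ : x ^ (m + 1) ∣ s₀ :=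
    ((pow_dvd_pow x Nat.lt_two_pow_self.le).trans
      (pow_dvd_pow_of_dvd ((hR.dvd_total _ _).resolve_left (h (m + 1))) _)).trans (hs (m + 1))
  refine hs₀' (eq_zero_of_eq_mul (Ideal.mul_mem_right (c * d) _ hx) ?_)
  rw [smul_eq_mul]
  linear_combination hd + x * d * hc

theorem isCountablySpanned_ideal (hR : IsChainRing R) (harch : IsArchimedeanLocalRing R)
    (I : Ideal R) : I.IsCountablySpanned := by
  classical
  by_cases hI : I.FG
  · exact Submodule.FG.isCountablySpanned hI
  have hI' : I ≠ ⊥ := fun h => hI (h ▸ Submodule.fg_bot)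
  obtain ⟨s, hs, hs'⟩ := hR.exists_seq_dvd harch
  refine ⟨I ∩ Set.range fun i : ℕ × ℕ => s i.1 ^ i.2,
    (Set.countable_range _).mono Set.inter_subset_right,
    le_antisymm (Submodule.span_le.2 Set.inter_subset_left) fun x hx => ?_⟩
  obtain ⟨b, hb, p, hp, rfl⟩ := hR.exists_eq_mul_of_not_fg hI hx
  obtain ⟨n, r, rfl⟩ := hs' p hp
  have hk := harch.exists_pow_mem hI' (hs n)
  obtain ⟨k, hk'⟩ : ∃ k, Nat.find hk = k + 1 := Nat.exists_eq_succ_of_ne_zero fun h => hI (by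
    rw [(Ideal.eq_top_iff_one I).2 (by simpa using (Nat.find_eq_zero hk).1 h)]
    exact ⟨{1}, by simp⟩)
  obtain ⟨c, rfl⟩ := (hR.mem_or_forall_dvd I (s n ^ k)).resolve_left
    (Nat.find_min hk (by omega)) b hb
  rw [show s n * r * (s n ^ k * c) = (r * c) • s n ^ (k + 1) by rw [smul_eq_mul]; ring]
  refine Submodule.smul_mem _ _ (Submodule.subset_span ⟨?_, (n, k + 1), rfl⟩)
  rw [← hk']
  exact Nat.find_spec hk

/-- Uniserial modules over an Archimedean chain ring are countably generated. -/
theorem isCountablySpanned_top_of_uniserial (hR : IsChainRing R)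
    (harch : IsArchimedeanLocalRing R) {G : Type*} [AddCommGroup G] [Module R G]
    (hG : ∀ A B : Submodule R G, A ≤ B ∨ B ≤ A) : (⊤ : Submodule R G).IsCountablySpanned := by
  classical
  by_cases hfg : (⊤ : Submodule R G).FG
  · exact hfg.isCountablySpanned
  have htot (g : G) (A : Submodule R G) : g ∈ A ∨ ∀ h ∈ A, ∃ c : R, c • g = h :=
    (hG (R ∙ g) A).imp (fun h => h (Submodule.mem_span_singleton_self g))
      fun h x hx => Submodule.mem_span_singleton.1 (h hx)
  have hdiv (g : G) : ∃ p ∈ maximalIdeal R, ∃ h : G, g = p • h := by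
    obtain ⟨h, hh⟩ : ∃ h, h ∉ R ∙ g := by
      by_contra! hh
      exact hfg ⟨{g}, by simpa using eq_top_iff.2 fun x _ => hh x⟩
    obtain ⟨c, hc⟩ := (htot h _).resolve_left hh g (Submodule.mem_span_singleton_self g)
    refine ⟨c, (mem_maximalIdeal c).2 fun hu => hh ?_, h, hc.symm⟩
    obtain ⟨u, rfl⟩ := hu
    exact Submodule.mem_span_singleton.2 ⟨(u⁻¹ : Rˣ), by simp [← hc, smul_smul]⟩
  obtain ⟨x, -, hx⟩ := (⊤ : Submodule R G).exists_mem_ne_zero_of_ne_bot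
    fun h => hfg (h ▸ Submodule.fg_bot)
  by_cases hA : ∃ s ∈ maximalIdeal R, ∀ m : ℕ, ∃ g : G, x = s ^ m • g
  · obtain ⟨s, hs, hA⟩ := hA
    choose g hg using hA
    refine ⟨Set.range g, Set.countable_range g, eq_top_iff.2 fun h _ => ?_⟩
    have hgm (m : ℕ) : g m ∈ Submodule.span R (Set.range g) := Submodule.subset_span ⟨m, rfl⟩
    refine (htot h _).resolve_right fun hh => hx ?_
    obtain ⟨d, hd⟩ := hh x (by rw [hg 0]; exact Submodule.smul_mem _ _ (hgm 0))
    obtain ⟨n, e, he⟩ := harch.exists_pow_eq_mul (a := d) (by rintro rfl; simp_all) hs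
    obtain ⟨c, hc⟩ := hh _ (hgm (n + 1))
    refine eq_zero_of_eq_mul (p := s * (e * c)) (Ideal.mul_mem_right _ _ hs) ?_
    conv_lhs => rw [hg (n + 1), ← hc]
    rw [← hd, smul_smul, smul_smul, pow_succ, he]
    congr 1
    ring
  · push Not at hA
    obtain ⟨s, hs, hs'⟩ := hR.exists_seq_dvd harch
    have (n : ℕ) : ∃ (m : ℕ) (g : G), x = s n ^ m • g ∧ ∀ h : G, x ≠ s n ^ (m + 1) • h := by
      have hm := hA _ (hs n)
      obtain ⟨m, hm'⟩ : ∃ m, Nat.find hm = m + 1 := Nat.exists_eq_succ_of_ne_zero fun h =>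
        (Nat.find_eq_zero hm).1 h x (by simp)
      have := Nat.find_min hm (m := m) (by omega)
      push Not at this
      obtain ⟨g, hg⟩ := this
      exact ⟨m, g, hg, hm' ▸ Nat.find_spec hm⟩
    choose m g hg hm using this
    refine ⟨Set.range g, Set.countable_range g, eq_top_iff.2 fun y _ => ?_⟩
    obtain ⟨p, hp, h, rfl⟩ := hdiv y
    obtain ⟨n, r, rfl⟩ := hs' p hp
    have hgn : g n ∈ Submodule.span R (Set.range g) := Submodule.subset_span ⟨n, rfl⟩
    rcases htot h (Submodule.span R (Set.range g)) with hh | hh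
    · exact Submodule.smul_mem _ _ hh
    obtain ⟨c, hc⟩ := hh _ hgn
    rcases hR.dvd_total (s n) c with ⟨d, rfl⟩ | ⟨d, hd⟩
    · refine absurd ?_ (hm n (d • h))
      rw [smul_smul, pow_succ, mul_assoc, ← smul_smul, hc]
      exact hg n
    · rw [show (s n * r) • h = (r * d) • g n by rw [← hc, smul_smul, hd]; congr 1; ring]
      exact Submodule.smul_mem _ _ hgn

end IsChainRing

/-- In an FP-injective module, elements killed by `(0 : b)` are divisible by `b`. -/
theorem IsFPInjective.exists_eq_smul {R : Type u} [CommRing R] {E : Type u} [AddCommGroup E]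
    [Module R E] (hE : IsFPInjective R E) {b : R} {x : E} (h : ∀ r : R, r * b = 0 → r • x = 0) :
    ∃ y, x = b • y := by
  let I : Ideal R := Ideal.span {b}
  have : Module.FinitePresentation R (R ⧸ I) :=
    Module.finitePresentation_of_surjective I.mkQ I.mkQ_surjective
      (by rw [Submodule.ker_mkQ]; exact ⟨{b}, by simp [I]⟩)
  have h0 := (isZero_ext_succ_iff _ _ 0).1 (hE (ModuleCat.of R (R ⧸ I)) this)
  have hle : LinearMap.ker (LinearMap.toSpanSingleton R R b) ≤
      LinearMap.ker (LinearMap.toSpanSingleton R E x) := fun r hr => by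
    simpa using h r (by simpa using hr)
  let l : I →ₗ[R] E := Submodule.liftQ _ _ hle ∘ₗ
    (LinearMap.toSpanSingleton R R b).quotKerEquivRange.symm.toLinearMap ∘ₗ
    (LinearEquiv.ofEq _ _ (LinearMap.range_toSpanSingleton (R := R) b).symm).toLinearMap
  have hl : l ⟨b, Ideal.mem_span_singleton_self b⟩ = x := by
    have : (LinearMap.toSpanSingleton R R b).quotKerEquivRange.symm ⟨b, 1, by simp⟩ =
        (LinearMap.ker (LinearMap.toSpanSingleton R R b)).mkQ 1 := by
      rw [LinearEquiv.symm_apply_eq]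
      exact Subtype.ext (one_smul R b).symm
    change Submodule.liftQ _ _ hle (
      (LinearMap.toSpanSingleton R R b).quotKerEquivRange.symm ⟨b, _⟩) = x
    rw [this, Submodule.mkQ_apply, Submodule.liftQ_apply, LinearMap.toSpanSingleton_apply_one]
  have hS := shortExact_of_function_exact (f := I.subtype) (g := I.mkQ) I.injective_subtype
    I.mkQ_surjective (LinearMap.exact_subtype_mkQ I)
  obtain ⟨e, he⟩ := Abelian.Ext.contravariant_sequence_exact₁ hS (ModuleCat.of R E)
    (Abelian.Ext.mk₀ (ModuleCat.ofHom l)) (n₁ := 1) (by simp) (h0 _)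
  obtain ⟨e, rfl⟩ := (Abelian.Ext.mk₀_bijective _ _).2 e
  rw [Abelian.Ext.mk₀_comp_mk₀] at he
  have he := (Abelian.Ext.mk₀_bijective _ _).1 he
  refine ⟨e.hom 1, ?_⟩
  rw [← map_smul, smul_eq_mul, mul_one, ← hl]
  have := LinearMap.congr_fun (congrArg ModuleCat.Hom.hom he) ⟨b, Ideal.mem_span_singleton_self b⟩
  exact this.symm

theorem IsPureSubmodule.exists_smul_eq {R : Type u} [CommRing R] {E : Type u} [AddCommGroup E]
    [Module R E] {D : Submodule R E} (hD : IsPureSubmodule D) {a : R} {x : E} (h : a • x ∈ D) :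
    ∃ d ∈ D, a • d = a • x := by
  let I : Ideal R := Ideal.span {a}
  have key (d : D) (hd : d ⊗ₜ[R] (Ideal.Quotient.mk I 1) = 0) : d ∈ I • (⊤ : Submodule R D) := by
    rw [← Submodule.Quotient.mk_eq_zero, ← (TensorProduct.tensorQuotEquivQuotSMul D I).map_zero,
      ← hd]
    simpa using (TensorProduct.tensorQuotEquivQuotSMul_tmul_mk I d 1).symm
  have := key ⟨a • x, h⟩ (by
    apply hD (R ⧸ I)
    rw [LinearMap.rTensor_tmul, map_zero]
    change (a • x) ⊗ₜ[R] (Ideal.Quotient.mk I 1) = 0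
    rw [TensorProduct.smul_tmul]
    rw [show a • Ideal.Quotient.mk I 1 = 0 from Ideal.Quotient.eq_zero_iff_mem.2
      (I.mul_mem_right _ (Ideal.mem_span_singleton_self a)), TensorProduct.tmul_zero])
  rw [Submodule.ideal_span_singleton_smul, Submodule.mem_smul_pointwise_iff_exists] at this
  obtain ⟨y, -, hy⟩ := this
  exact ⟨y, y.2, congrArg Subtype.val hy⟩

/-- Divisibility properties of annihilators of elements pass from FP-injective modules to almost
FP-injective modules. -/
theorem IsAlmostFPInjective.exists_smul_eq_smul {R : Type u} [CommRing R] {G : Type u}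
    [AddCommGroup G] [Module R G] (hG : IsAlmostFPInjective R G) {a q : R}
    (h : ∀ (E : Type u) [AddCommGroup E] [Module R E], IsFPInjective R E → ∀ x : E, a • x = 0 →
      ∃ b, a * b = 0 ∧ ∃ y : E, q • x = b • y) {g : G} (hg : a • g = 0) :
    ∃ b, a * b = 0 ∧ ∃ y : G, q • g = b • y := by
  obtain ⟨E, _, _, D, hE, hD, ⟨e⟩⟩ := hG
  obtain ⟨x, rfl⟩ := e.surjective g
  obtain ⟨x, rfl⟩ := D.mkQ_surjective x
  rw [← map_smul, e.map_eq_zero_iff, ← map_smul, Submodule.mkQ_apply,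
    Submodule.Quotient.mk_eq_zero] at hg
  obtain ⟨d, hd, hd'⟩ := hD.exists_smul_eq hg
  obtain ⟨b, hb, y, hy⟩ := h E hE (x - d) (by rw [smul_sub, hd', sub_self])
  refine ⟨b, hb, e (D.mkQ y), ?_⟩
  rw [← map_smul, ← map_smul, ← map_smul, ← map_smul, ← hy, smul_sub, map_sub,
    D.mkQ_apply (q • d), (Submodule.Quotient.mk_eq_zero D).2 (D.smul_mem q hd), sub_zero]

theorem IsChainRing.flat_of_isAlmostFPInjective_of_isIFRing {R : Type u} [CommRing R]
    (hR : IsChainRing R) (hIF : IsIFRing R) {G : Type u} [AddCommGroup G] [Module R G]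
    (hG : IsAlmostFPInjective R G) : Module.Flat R G := by
  refine hR.flat_iff.2 fun a g hg => ?_
  suffices ∃ b, a * b = 0 ∧ ∃ y : G, (1 : R) • g = b • y by simpa only [one_smul] using this
  refine hG.exists_smul_eq_smul (fun E _ _ hE x hx => ?_) hg
  let i := Injective.ι (ModuleCat.of R E)
  have hi : Function.Injective i.hom := (ModuleCat.mono_iff_injective i).1 inferInstance
  let J : ModuleCat R := Injective.under (ModuleCat.of R E)
  have hJ : Injective J := inferInstanceAs (Injective (Injective.under (ModuleCat.of R E)))
  have : Module.Flat R J := hIF _ (Module.injective_module_of_injective_object R J)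
  obtain ⟨b, hb, y, hy⟩ := hR.flat_iff.1 this a (i.hom x) (by rw [← map_smul, hx, map_zero])
  refine ⟨b, hb, ?_⟩
  rw [one_smul]
  refine hE.exists_eq_smul fun r hr => hi ?_
  rw [map_smul, hy, smul_smul, hr, zero_smul, map_zero]

/-- Countably generated modules over a valuation domain all of whose ideals are countably generated
have projective dimension at most two. -/
theorem IsChainRing.hasProjectiveDimensionLT_three_of_isDomain {R : Type u} [CommRing R]
    [IsDomain R] (hR : IsChainRing R) (hc : ∀ I : Ideal R, I.IsCountablySpanned) (M : Type u)
    [AddCommGroup M] [Module R M] (hM : (⊤ : Submodule R M).IsCountablySpanned) :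
    HasProjectiveDimensionLT (ModuleCat.of R M) 3 := by
  obtain ⟨p, hp⟩ := hM.exists_surjective
  have hK := (isCountablySpanned_of_finsupp_nat hc (LinearMap.ker p)).top
  have : Module.Flat R (LinearMap.ker p) :=
    (IsChainRing.flat_iff (M := LinearMap.ker p) hR).2 fun a m h => by
      rcases smul_eq_zero.1 h with rfl | rfl
      · exact ⟨1, by simp, m, by simp⟩
      · exact ⟨0, by simp, 0, by simp⟩
  exact hasProjectiveDimensionLT_right_of_exact (A := LinearMap.ker p)
    (LinearMap.ker p).injective_subtype hp (LinearMap.exact_subtype_ker_map p)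
    (hasProjectiveDimensionLT_two_of_flat hc _ hK)
    (hasProjectiveDimensionLT_succ_of_projective _ 2)

/-- The annihilator of an element of a ring. -/
abbrev annOf {R : Type u} [CommRing R] (a : R) : Ideal R :=
  LinearMap.ker (LinearMap.toSpanSingleton R R a)

namespace IsChainRing

open IsLocalRing

variable {R : Type u} [CommRing R]

theorem exists_not_fg_annOf (hR : IsChainRing R) (hc : ¬ IsCoherentRing R) :
    ∃ a : R, ¬ (annOf a).FG := by
  by_contra! h
  refine hc fun I hI => ?_
  obtain ⟨a, rfl⟩ := hR.exists_eq_span_singleton hI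
  let a' : Ideal.span {a} := ⟨a, Ideal.mem_span_singleton_self a⟩
  refine Module.finitePresentation_of_surjective (LinearMap.toSpanSingleton R _ a') ?_ ?_
  · rintro ⟨x, hx⟩
    obtain ⟨r, rfl⟩ := Ideal.mem_span_singleton'.1 hx
    exact ⟨r, rfl⟩
  · rw [show LinearMap.ker (LinearMap.toSpanSingleton R (Ideal.span {a}) a') = annOf a by
      ext r
      simp [a', Subtype.ext_iff]]
    exact h a

variable [IsLocalRing R]

theorem not_fg_maximalIdeal (harch : IsArchimedeanLocalRing R) {a : R} (ha : ¬ (annOf a).FG) :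
    ¬ (maximalIdeal R).FG := by
  intro hP
  have : IsNoetherianRing R := IsNoetherianRing.of_prime fun I hI => by
    by_cases h : I = ⊥
    · rw [h]
      exact Submodule.fg_bot
    · rwa [harch I hI h]
  exact ha (IsNoetherian.noetherian _)

theorem annOf_ne_bot (harch : IsArchimedeanLocalRing R) {a₀ : R} (ha₀ : ¬ (annOf a₀).FG) {a : R}
    (ha : a ∈ maximalIdeal R) : annOf a ≠ ⊥ := by
  classical
  have h := harch.exists_pow_mem (I := annOf a₀) (fun h => ha₀ (h ▸ Submodule.fg_bot)) ha
  have hn := Nat.find_spec h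
  obtain ⟨n, hn'⟩ := Nat.exists_eq_succ_of_ne_zero fun h0 : Nat.find h = 0 => ha₀ (by
    rw [h0, pow_zero] at hn
    rw [(Ideal.eq_top_iff_one _).2 hn]
    exact ⟨{1}, by simp⟩)
  have hmin := Nat.find_min h (m := n) (by omega)
  rw [hn', Nat.succ_eq_add_one] at hn
  intro hbot
  have : a ^ n * a₀ ∈ annOf a := by
    simp only [LinearMap.mem_ker, LinearMap.toSpanSingleton_apply, smul_eq_mul] at hn ⊢
    linear_combination hn
  rw [hbot] at this
  exact hmin (by simpa using this)

theorem not_fg_annOf (hR : IsChainRing R) (harch : IsArchimedeanLocalRing R) {a₀ : R}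
    (ha₀ : ¬ (annOf a₀).FG) {a : R} (ha : a ∈ maximalIdeal R) (ha' : a ≠ 0) :
    ¬ (annOf a).FG := by
  intro hfg
  have hbot := annOf_ne_bot harch ha₀ ha
  obtain ⟨b, hb⟩ := hR.exists_eq_span_singleton hfg
  have hb0 : b ≠ 0 := by
    rintro rfl
    exact hbot (by simpa using hb)
  have hab (r : R) : r * a = 0 ↔ b ∣ r := by
    rw [← Ideal.mem_span_singleton, ← hb]
    simp
  have hba : b * a = 0 := (hab b).2 dvd_rfl
  have hne : a₀ ≠ 0 := by
    rintro rfl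
    exact ha₀ ⟨{1}, by ext; simp⟩
  suffices ∃ c, annOf a₀ = Ideal.span {c} by
    obtain ⟨c, hc⟩ := this
    exact ha₀ ⟨{c}, by rw [hc, Finset.coe_singleton]⟩
  rcases hR.dvd_total a₀ a with ⟨c, hc⟩ | ⟨c, hc⟩
  · refine ⟨b * c, le_antisymm (fun r hr => ?_) ?_⟩
    · have hr : r * a₀ = 0 := by simpa using hr
      rcases hR.dvd_total c r with ⟨s, rfl⟩ | ⟨s, rfl⟩
      · obtain ⟨t, rfl⟩ := (hab s).1 (by rw [hc]; linear_combination hr)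
        exact Ideal.mem_span_singleton'.2 ⟨t, by ring⟩
      · exact absurd (by rw [hc]; linear_combination s * hr) ha'
    · rw [Ideal.span_singleton_le_iff_mem]
      simp only [LinearMap.mem_ker, LinearMap.toSpanSingleton_apply, smul_eq_mul]
      rw [hc] at hba
      linear_combination hba
  · rcases hR.dvd_total c b with ⟨b', hb'⟩ | ⟨d, rfl⟩
    · refine ⟨b', le_antisymm (fun r hr => ?_) ?_⟩
      · have hr : r * a₀ = 0 := by simpa using hr
        obtain ⟨t, ht⟩ := (hab (r * c)).1 (by rw [hc] at hr; linear_combination hr)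
        refine Ideal.mem_span_singleton.2 ((hR.dvd_total b' r).elim id ?_)
        rintro ⟨w, rfl⟩
        by_cases hw : w ∈ maximalIdeal R
        · have := eq_zero_of_eq_mul (x := r * c) (Ideal.mul_mem_left _ t hw) (by
            rw [smul_eq_mul]; linear_combination ht + t * hb')
          exact absurd (by linear_combination hb' + w * this) hb0
        · rw [mem_maximalIdeal, mem_nonunits_iff, not_not] at hw
          exact hw.mul_right_dvd.2 dvd_rfl
      · rw [Ideal.span_singleton_le_iff_mem]
        simp only [LinearMap.mem_ker, LinearMap.toSpanSingleton_apply, smul_eq_mul]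
        linear_combination b' * hc + hba - a * hb'
    · exact absurd (by rw [hc]; linear_combination d * hba) hne

theorem exists_mul_eq_zero_and_forall_dvd (hR : IsChainRing R) (harch : IsArchimedeanLocalRing R)
    {a p : R} (hbot : annOf a ≠ ⊥) (ha : a ≠ 0) (hp : p ∈ maximalIdeal R) :
    ∃ b, a * b = 0 ∧ ∀ r, r * b = 0 → a ∣ p * r := by
  by_contra! h
  have h (b : R) (hb : a * b = 0) : ∃ c, a = p * c ∧ c * b = 0 := by
    obtain ⟨r, hr, hd⟩ := h b hb
    obtain ⟨e, he⟩ := (hR.dvd_total a (p * r)).resolve_left hd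
    exact ⟨r * e, by rw [he]; ring, by linear_combination e * hr⟩
  obtain ⟨c, hc, -⟩ := h 0 (mul_zero a)
  have hle (b : R) (hb : a * b = 0) : c * b = 0 := by
    obtain ⟨c', hc', hb'⟩ := h b hb
    rcases hR.dvd_total c (c - c') with ⟨w, hw⟩ | ⟨w, hw⟩
    · have hwP : w ∈ maximalIdeal R := (mem_maximalIdeal w).2 fun hu =>
        ha (hu.mul_left_eq_zero.1 (by linear_combination (w - 1) * hc + hc' - p * hw))
      refine eq_zero_of_eq_mul hwP ?_
      rw [smul_eq_mul]
      linear_combination hb' + b * hw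
    · exact absurd (by linear_combination hc + p * hw + w * (hc' - hc)) ha
  obtain ⟨n, hn⟩ := harch.exists_pow_mem (I := annOf c) (fun hb => hbot (le_bot_iff.1 (by
    rw [← hb]
    intro b hb
    have := hle b (by simpa [mul_comm] using hb)
    simpa [mul_comm] using this))) hp
  replace hn : c * p ^ n = 0 := by simpa [mul_comm] using hn
  refine ha ?_
  rw [hc]
  suffices c = 0 by rw [this, mul_zero]
  induction n with
  | zero => simpa using hn
  | succ n ih => exact ih (hle _ (by
      rw [hc, ← hn]; ring))

end IsChainRing

namespace IsChainRing

open IsLocalRing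

variable {R : Type u} [CommRing R] [IsLocalRing R]

theorem flat_maximalIdeal (hR : IsChainRing R) (harch : IsArchimedeanLocalRing R) {a₀ : R}
    (ha₀ : ¬ (annOf a₀).FG) : Module.Flat R (maximalIdeal R) := by
  refine (IsChainRing.flat_iff (M := maximalIdeal R) hR).2 fun a m h => ?_
  by_cases ha0 : a = 0
  · exact ⟨1, by simp [ha0], m, by simp⟩
  by_cases ha : a ∈ maximalIdeal R
  · obtain ⟨b, hb, q, hq, h'⟩ := hR.exists_eq_mul_of_not_fg (not_fg_annOf hR harch ha₀ ha ha0)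
      (a := (m : R)) (by simpa [Subtype.ext_iff, mul_comm] using h)
    exact ⟨b, by simpa [mul_comm] using hb, ⟨q, hq⟩, Subtype.ext (by rw [h', mul_comm]; rfl)⟩
  · rw [mem_maximalIdeal, mem_nonunits_iff, not_not] at ha
    exact ⟨0, by simp, 0, by rw [ha.smul_eq_zero.1 h, zero_smul]⟩

theorem exists_smul_eq_smul_of_isAlmostFPInjective (hR : IsChainRing R)
    (harch : IsArchimedeanLocalRing R) {a p : R} (hbot : annOf a ≠ ⊥) (ha : a ≠ 0)
    (hp : p ∈ maximalIdeal R) {G : Type u} [AddCommGroup G] [Module R G]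
    (hG : IsAlmostFPInjective R G) {g : G} (hg : a • g = 0) :
    ∃ b, a * b = 0 ∧ ∃ y : G, p • g = b • y := by
  refine hG.exists_smul_eq_smul (fun E _ _ hE x hx => ?_) hg
  obtain ⟨b, hb, h⟩ := hR.exists_mul_eq_zero_and_forall_dvd harch hbot ha hp
  refine ⟨b, hb, hE.exists_eq_smul fun r hr => ?_⟩
  obtain ⟨c, hc⟩ := h r hr
  rw [smul_smul, mul_comm, hc, mul_comm, mul_smul, hx, smul_zero]

theorem flat_maximalIdeal_tensorProduct (hR : IsChainRing R) (harch : IsArchimedeanLocalRing R)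
    {a₀ : R} (ha₀ : ¬ (annOf a₀).FG) {G : Type u} [AddCommGroup G] [Module R G]
    (hG : IsAlmostFPInjective R G) : Module.Flat R (TensorProduct R (maximalIdeal R) G) := by
  have := hR.flat_maximalIdeal harch ha₀
  refine hR.flat_iff.2 fun a z hz => ?_
  by_cases ha0 : a = 0
  · exact ⟨1, by simp [ha0], z, by simp⟩
  by_cases ha : a ∈ maximalIdeal R
  · have hex := Module.Flat.lTensor_exact (maximalIdeal R)
      (LinearMap.exact_subtype_ker_map (LinearMap.lsmul R G a))
    obtain ⟨w, rfl⟩ := (hex z).1 ((LinearMap.congr_fun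
      (LinearMap.lTensor_smul_action (maximalIdeal R) G a) z).trans hz)
    suffices LinearMap.lTensor (maximalIdeal R) (LinearMap.ker (LinearMap.lsmul R G a)).subtype w ∈
        annOf a • (⊤ : Submodule R (TensorProduct R (maximalIdeal R) G)) by
      obtain ⟨b, hb, hy⟩ := hR.exists_eq_smul_of_mem_smul_top this
      exact ⟨b, by simpa [mul_comm] using hb, hy⟩
    clear hz
    induction w using TensorProduct.induction_on with
    | zero => rw [map_zero]; exact Submodule.zero_mem _
    | add x y hx hy => rw [map_add]; exact Submodule.add_mem _ hx hy
    | tmul p g =>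
      obtain ⟨p₂, hp₂, q, hq, h⟩ := hR.exists_eq_mul_of_not_fg (not_fg_maximalIdeal harch ha₀) p.2
      obtain ⟨b, hb, y, hy⟩ := hR.exists_smul_eq_smul_of_isAlmostFPInjective harch
        (annOf_ne_bot harch ha₀ ha) ha0 hq hG (g := g) g.2
      rw [LinearMap.lTensor_tmul, show p = q • (⟨p₂, hp₂⟩ : maximalIdeal R) from Subtype.ext h,
        TensorProduct.smul_tmul, Submodule.subtype_apply, hy, TensorProduct.tmul_smul]
      exact Submodule.smul_mem_smul (by simpa [mul_comm] using hb) Submodule.mem_top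
  · rw [mem_maximalIdeal, mem_nonunits_iff, not_not] at ha
    exact ⟨0, by simp, 0, by rw [ha.smul_eq_zero.1 hz, zero_smul]⟩

end IsChainRing

/-- If `P` is a maximal ideal such that `P` and `P ⊗ G` have projective dimension at most one, then
`G` has projective dimension at most three. -/
theorem hasProjectiveDimensionLT_four_of_tensorProduct {R : Type u} [CommRing R] (P : Ideal R)
    [P.IsMaximal] (hP : HasProjectiveDimensionLT (ModuleCat.of R P) 2) {G : Type u}
    [AddCommGroup G] [Module R G]
    (hPG : HasProjectiveDimensionLT (ModuleCat.of R (TensorProduct R P G)) 2) :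
    HasProjectiveDimensionLT (ModuleCat.of R G) 4 := by
  have hk : HasProjectiveDimensionLT (ModuleCat.of R (R ⧸ P)) 3 :=
    hasProjectiveDimensionLT_right_of_exact (f := P.subtype) (g := P.mkQ) P.injective_subtype
      P.mkQ_surjective (LinearMap.exact_subtype_mkQ P) hP
      (hasProjectiveDimensionLT_succ_of_projective R 2)
  let μ : TensorProduct R P G →ₗ[R] G := TensorProduct.lift (LinearMap.lsmul R G ∘ₗ P.subtype)
  have hμ (p : P) (z : TensorProduct R P G) : (p : R) • z = p ⊗ₜ μ z := by
    induction z using TensorProduct.induction_on with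
    | zero => simp
    | add x y hx hy => rw [smul_add, map_add, TensorProduct.tmul_add, hx, hy]
    | tmul q g =>
      change _ = p ⊗ₜ ((q : R) • g)
      rw [← TensorProduct.smul_tmul, TensorProduct.smul_tmul']
      congr 1
      exact Subtype.ext (mul_comm _ _)
  have hT : HasProjectiveDimensionLT (ModuleCat.of R (LinearMap.ker μ)) 3 :=
    hasProjectiveDimensionLT_of_forall_smul_eq_zero P hk (LinearMap.ker μ) fun p hp z =>
      Subtype.ext ((hμ ⟨p, hp⟩ z).trans (by
        rw [LinearMap.mem_ker.1 z.2, TensorProduct.tmul_zero]; rfl))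
  have hrange : HasProjectiveDimensionLT (ModuleCat.of R (LinearMap.range μ)) 4 :=
    hasProjectiveDimensionLT_right_of_exact (A := LinearMap.ker μ) (C := LinearMap.range μ)
      (f := (LinearMap.ker μ).subtype) (g := μ.rangeRestrict) (LinearMap.ker μ).injective_subtype
      μ.surjective_rangeRestrict (LinearMap.exact_iff.2 (by simp)) hT
      (hasProjectiveDimensionLT_of_ge _ 2 4 (by omega))
  have hQ : HasProjectiveDimensionLT (ModuleCat.of R (G ⧸ LinearMap.range μ)) 3 :=
    hasProjectiveDimensionLT_of_forall_smul_eq_zero P hk _ fun p hp z => by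
      obtain ⟨g, rfl⟩ := Submodule.mkQ_surjective _ z
      exact (Submodule.Quotient.mk_eq_zero _).2 ⟨⟨p, hp⟩ ⊗ₜ g, rfl⟩
  exact hasProjectiveDimensionLT_middle_of_exact (A := LinearMap.range μ)
    (LinearMap.range μ).injective_subtype (LinearMap.range μ).mkQ_surjective
    (LinearMap.exact_subtype_mkQ _) hrange (hasProjectiveDimensionLT_of_ge _ 3 4 (by omega))

/-- Let `R` be an Archimedean chain ring with maximal ideal `P` and `G`
an almost FP-injective module which is countably generated or uniserial. Then
(1) `p.d.(G) ≤ 1` if `R` is an IF-ring; (2) `p.d.(G) ≤ 2` if `R` is a (valuation) domain;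
(3) `p.d.(G) ≤ 3` and `p.d.(P ⊗_R G) ≤ 1` if `R` is not coherent. -/
theorem projDim_of_almostFPInjective_archimedean (R : Type u) [CommRing R] [IsLocalRing R]
    (hR : IsChainRing R)
    (harch : ∀ I : Ideal R, I.IsPrime → I ≠ ⊥ → I = IsLocalRing.maximalIdeal R)
    (G : Type u) [AddCommGroup G] [Module R G] (hG : IsAlmostFPInjective R G)
    (hcu : (∃ S : Set G, S.Countable ∧ Submodule.span R S = ⊤) ∨
           (∀ A B : Submodule R G, A ≤ B ∨ B ≤ A)) :
    (IsIFRing R → projDim R G ≤ 1) ∧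
    (IsDomain R → projDim R G ≤ 2) ∧
    (¬ IsCoherentRing R → projDim R G ≤ 3 ∧
      projDim R (TensorProduct R (IsLocalRing.maximalIdeal R) G) ≤ 1) := by
  have hc := hR.isCountablySpanned_ideal harch
  have hcG : (⊤ : Submodule R G).IsCountablySpanned :=
    hcu.elim id (hR.isCountablySpanned_top_of_uniserial harch)
  refine ⟨fun hIF => ?_, fun _ => ?_, fun hcoh => ?_⟩
  · have := hR.flat_of_isAlmostFPInjective_of_isIFRing hIF hG
    exact projDim_le_of_hasProjectiveDimensionLT (k := 1)
      (hasProjectiveDimensionLT_two_of_flat hc G hcG)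
  · exact projDim_le_of_hasProjectiveDimensionLT (k := 2)
      (hR.hasProjectiveDimensionLT_three_of_isDomain hc G hcG)
  · obtain ⟨a₀, ha₀⟩ := hR.exists_not_fg_annOf hcoh
    have hcP := (hc (IsLocalRing.maximalIdeal R)).top
    have := hR.flat_maximalIdeal harch ha₀
    have := hR.flat_maximalIdeal_tensorProduct harch ha₀ hG
    have hPG := hasProjectiveDimensionLT_two_of_flat hc
      (TensorProduct R (IsLocalRing.maximalIdeal R) G)
      (isCountablySpanned_top_tensorProduct (M := IsLocalRing.maximalIdeal R) hcP hcG)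
    exact ⟨projDim_le_of_hasProjectiveDimensionLT (k := 3)
      (hasProjectiveDimensionLT_four_of_tensorProduct _
        (hasProjectiveDimensionLT_two_of_flat hc _ hcP) hPG),
      projDim_le_of_hasProjectiveDimensionLT (k := 1) hPG⟩
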